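/- arXiv:2011.09904 — 2 statements merged into one kernel-verified Lean document; each statement's English description precedes it below -/
import Mathlib

section
/- Let M be an algebraically closed field that is algebraic over a subfield K, and let L be an intermediate field with K ⊆ L ⊆ M. Then L is separable over K if and only if every element of the tensor product M ⊗_K L is a unit times an idempotent, i.e., for every x ∈ M ⊗_K L there exist a unit u and an idempotent e with x = u·e. -/
open TensorProduct

/-- An element of a reduced algebra that is integral over a field is a unit times an idempotent. -/
theorem IsIntegral.exists_unit_mul_isIdempotentElem {k A : Type*} [Field k] [CommRing A]
    [Algebra k A] [IsReduced A] {x : A} (hx : IsIntegral k x) :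
    ∃ (u : Aˣ) (e : A), IsIdempotentElem e ∧ x = u * e := by
  obtain ⟨y, hy⟩ : ∃ y, x * x * y = x := by
    obtain ⟨g, hg, hg0⟩ := Polynomial.exists_eq_pow_rootMultiplicity_mul_and_not_dvd
      (minpoly k x) (minpoly.ne_zero hx) 0
    rw [Polynomial.C_0, sub_zero] at hg hg0
    set n := (minpoly k x).rootMultiplicity 0
    rw [Polynomial.X_dvd_iff] at hg0
    have h := minpoly.aeval k x
    rw [hg, map_mul, map_pow, Polynomial.aeval_X] at h
    have hz : x * Polynomial.aeval x g = 0 := by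
      refine pow_eq_zero_iff (n := n + 1) n.succ_ne_zero |>.mp ?_
      linear_combination x * Polynomial.aeval x g ^ n * h
    rw [← g.divX_mul_X_add] at hz
    simp only [map_add, map_mul, Polynomial.aeval_X, Polynomial.aeval_C] at hz
    have hc : algebraMap k A (g.coeff 0)⁻¹ * algebraMap k A (g.coeff 0) = 1 := by
      rw [← map_mul, inv_mul_cancel₀ hg0, map_one]
    refine ⟨-(algebraMap k A (g.coeff 0)⁻¹ * Polynomial.aeval x g.divX), ?_⟩
    linear_combination x * hc - algebraMap k A (g.coeff 0)⁻¹ * hz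
  refine ⟨⟨x + 1 - x * y, x * y * y + 1 - x * y, ?_, ?_⟩, x * y, ?_, ?_⟩
  · linear_combination (2 * y - 1 - y * y) * hy
  · linear_combination (2 * y - 1 - y * y) * hy
  · unfold IsIdempotentElem
    linear_combination y * hy
  · change x = (x + 1 - x * y) * (x * y)
    linear_combination (y - 1) * hy

theorem isReduced_of_forall_exists_unit_mul_isIdempotentElem {A : Type*} [CommRing A]
    (h : ∀ x : A, ∃ (u : Aˣ) (e : A), IsIdempotentElem e ∧ x = u * e) : IsReduced A := by
  refine ⟨fun x ⟨n, hn⟩ ↦ ?_⟩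
  obtain ⟨u, e, he, rfl⟩ := h x
  rw [mul_pow, ← Units.val_pow_eq_pow_val, Units.mul_right_eq_zero] at hn
  rw [← he.pow_succ_eq n, pow_succ, hn, zero_mul, mul_zero]

theorem isReduced_tensorProduct_of_isSeparable (K L M : Type*) [Field K] [Field L] [Field M]
    [Algebra K L] [Algebra K M] [Algebra.IsSeparable K L] : IsReduced (M ⊗[K] L) := by
  refine IsReduced.tensorProduct_of_flat_of_forall_fg fun B hB ↦ ?_
  let : Field B := (Subalgebra.isField_of_algebraic B).toField
  have : Algebra.FiniteType K B := B.fg_iff_finiteType.mp hB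
  have : Algebra.IsSeparable K B := .of_algHom K L B.val
  have := Algebra.FormallyUnramified.of_isSeparable K B
  exact Algebra.FormallyUnramified.isReduced_of_field M (M ⊗[K] B)

theorem natDegree_minpoly_le_of_aeval_tmul_eq_zero {K L M : Type*} [Field K] [Field L] [Field M]
    [Algebra K L] [Algebra K M] (a : L) {q : Polynomial M} (hq : q ≠ 0)
    (h : Polynomial.aeval ((1 : M) ⊗ₜ[K] a) q = 0) :
    (minpoly K a).natDegree ≤ q.natDegree := by
  by_contra! hlt
  have hli := Module.Flat.linearIndependent_one_tmul (S := M) (linearIndependent_pow (K := K) a)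
  rw [Polynomial.aeval_eq_sum_range' hlt, ← Fin.sum_univ_eq_sum_range
    (fun i ↦ q.coeff i • ((1 : M) ⊗ₜ[K] a) ^ i)] at h
  have h0 := Fintype.linearIndependent_iff.mp hli (fun i ↦ q.coeff i)
    (by simpa [Algebra.TensorProduct.tmul_pow] using h)
  exact hq (Polynomial.leadingCoeff_eq_zero.mp (h0 ⟨q.natDegree, hlt⟩))

theorem isSeparable_of_isReduced_tensorProduct (K L M : Type*) [Field K] [Field L] [Field M]
    [Algebra K L] [Algebra K M] [PerfectField M] [Algebra.IsAlgebraic K L]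
    [IsReduced (M ⊗[K] L)] : Algebra.IsSeparable K L := by
  refine ⟨fun a ↦ ?_⟩
  have hp0 := minpoly.ne_zero (Algebra.IsIntegral.isIntegral (R := K) a)
  rw [IsSeparable, ← Polynomial.separable_map (algebraMap K M),
    PerfectField.separable_iff_squarefree]
  rintro f ⟨g, hg⟩
  have hfg : f * f * g ≠ 0 := hg ▸ Polynomial.map_ne_zero hp0
  have hf : f ≠ 0 := by rintro rfl; simp at hfg
  have hg0 : g ≠ 0 := by rintro rfl; simp at hfg
  have haeval : Polynomial.aeval ((1 : M) ⊗ₜ[K] a) (f * f * g) = 0 := by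
    rw [← hg, Polynomial.aeval_map_algebraMap, ← Algebra.TensorProduct.includeRight_apply,
      Polynomial.aeval_algHom_apply, minpoly.aeval, map_zero]
  have hred : Polynomial.aeval ((1 : M) ⊗ₜ[K] a) (f * g) = 0 := by
    refine pow_eq_zero_iff two_ne_zero |>.mp ?_
    rw [← map_pow, show (f * g) ^ 2 = f * f * g * g by ring, map_mul, haeval, zero_mul]
  have hle := natDegree_minpoly_le_of_aeval_tmul_eq_zero a (mul_ne_zero hf hg0) hred
  rw [← Polynomial.natDegree_map (algebraMap K M), hg, mul_assoc,
    Polynomial.natDegree_mul hf (mul_ne_zero hf hg0)] at hle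
  rw [Polynomial.natDegree_mul hf hg0] at hle
  rw [Polynomial.isUnit_iff_degree_eq_zero, Polynomial.degree_eq_natDegree hf]
  norm_cast
  omega

theorem separable_iff_unit_times_idempotent_of_intermediate
    (K L M : Type*) [Field K] [Field L] [Field M]
    [Algebra K L] [Algebra L M] [Algebra K M] [IsScalarTower K L M]
    [IsAlgClosed M] [Algebra.IsAlgebraic K M] :
    Algebra.IsSeparable K L ↔
      ∀ x : M ⊗[K] L, ∃ (u : (M ⊗[K] L)ˣ) (e : M ⊗[K] L),
        IsIdempotentElem e ∧ x = (u : M ⊗[K] L) * e := by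
  have : Algebra.IsAlgebraic K L := .tower_bot K L M
  refine ⟨fun _ x ↦ ?_, fun h ↦ ?_⟩
  · have := isReduced_tensorProduct_of_isSeparable K L M
    exact (Algebra.IsIntegral.isIntegral (R := M) x).exists_unit_mul_isIdempotentElem
  · have := isReduced_of_forall_exists_unit_mul_isIdempotentElem h
    exact isSeparable_of_isReduced_tensorProduct K L M
end

section
/- Let M be an algebraically closed field containing a field K, and let L be a field extension of K that is algebraic over K. Then L is separable over K if and only if the tensor product M ⊗_K L is generated as an M-algebra by its idempotent elements. -/
open TensorProduct

open Polynomial in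
/-- An element killed by a product of distinct monic linear factors is a linear combination of
idempotents. -/
theorem mem_adjoin_idempotents_of_aeval_nodal_eq_zero {F A : Type*} [Field F] [CommRing A]
    [Algebra F A] {s : Finset F} {a : A} (ha : aeval a (Lagrange.nodal s id) = 0) :
    a ∈ Algebra.adjoin F {e : A | IsIdempotentElem e} := by
  classical
  have congr_of_eval (f g : F[X]) (h : ∀ r ∈ s, f.eval r = g.eval r) : aeval a f = aeval a g := by
    have hdvd : Lagrange.nodal s id ∣ f - g := by
      rw [Lagrange.nodal_eq]
      refine Finset.prod_dvd_of_coprime (fun x _ y _ hxy => ?_) fun r hr => ?_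
      · exact pairwise_coprime_X_sub_C Function.injective_id hxy
      · rw [dvd_iff_isRoot, IsRoot, eval_sub, id, h r hr, sub_self]
    obtain ⟨q, hq⟩ := hdvd
    rw [← sub_eq_zero, ← map_sub, hq, map_mul, ha, zero_mul]
  have hinj : Set.InjOn (id : F → F) s := Function.injective_id.injOn
  have hidem (r : F) (hr : r ∈ s) : IsIdempotentElem (aeval a (Lagrange.basis s id r)) := by
    rw [IsIdempotentElem, ← map_mul]
    refine congr_of_eval _ _ fun t ht => ?_
    rw [eval_mul]
    rcases eq_or_ne r t with rfl | hrt
    · have := Lagrange.eval_basis_self hinj hr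
      simp only [id] at this
      rw [this, one_mul]
    · have := Lagrange.eval_basis_of_ne (v := (id : F → F)) hrt ht
      simp only [id] at this
      rw [this, zero_mul]
  have hX : a = aeval a (Lagrange.interpolate s id id) := by
    conv_lhs => rw [← aeval_X (R := F) a]
    refine congr_of_eval _ _ fun t ht => ?_
    rw [eval_X]
    exact (Lagrange.eval_interpolate_at_node (v := id) id hinj ht).symm
  rw [hX, Lagrange.interpolate_apply, map_sum]
  refine Subalgebra.sum_mem _ fun r hr => ?_
  rw [map_mul, aeval_C]
  exact mul_mem (Subalgebra.algebraMap_mem _ _) (Algebra.subset_adjoin (hidem r hr))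

/-- Adding a multiple of an idempotent preserves being killed by a product of distinct monic
linear factors. -/
theorem IsIdempotentElem.exists_prod_add_smul_sub_eq_zero {F A : Type*} [Field F] [CommRing A]
    [Algebra F A] {e : A} (he : IsIdempotentElem e) (c : F) {a : A}
    (ha : ∃ s : Finset F, ∏ r ∈ s, (a - algebraMap F A r) = 0) :
    ∃ s : Finset F, ∏ r ∈ s, (a + c • e - algebraMap F A r) = 0 := by
  classical
  obtain ⟨s, hs⟩ := ha
  have mul_prod_congr {d : A} (hd : IsIdempotentElem d) (t : Finset F) (f g : F → A)
      (h : ∀ r ∈ t, d * f r = d * g r) : d * ∏ r ∈ t, f r = d * ∏ r ∈ t, g r := by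
    induction t using Finset.induction_on with
    | empty => simp
    | insert r t hr ih =>
      have ih := ih fun r hr => h r (Finset.mem_insert_of_mem hr)
      have h := h r (Finset.mem_insert_self r t)
      rw [Finset.prod_insert hr, Finset.prod_insert hr]
      have hd : d * d = d := hd
      calc d * (f r * ∏ r ∈ t, f r) = (d * f r) * (d * ∏ r ∈ t, f r) := by
            nth_rw 1 [← hd]; ring
        _ = (d * g r) * (d * ∏ r ∈ t, g r) := by rw [h, ih]
        _ = d * (g r * ∏ r ∈ t, g r) := by
            nth_rw 3 [← hd]; ring
  let t := s.image (· + c)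
  have hee : e * e = e := he
  have hzero : e * ∏ r ∈ t, (a + c • e - algebraMap F A r) = 0 := by
    rw [Finset.prod_image fun _ _ _ _ h => add_right_cancel h,
      mul_prod_congr he s _ (fun r => a - algebraMap F A r), hs, mul_zero]
    intro r _
    rw [Algebra.smul_def, map_add]
    linear_combination algebraMap F A c * hee
  have hzero' : (1 - e) * ∏ r ∈ s, (a + c • e - algebraMap F A r) = 0 := by
    rw [mul_prod_congr he.one_sub s _ (fun r => a - algebraMap F A r), hs, mul_zero]
    intro r _
    rw [Algebra.smul_def]
    linear_combination -algebraMap F A c * hee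
  refine ⟨t ∪ s, ?_⟩
  obtain ⟨u, hu⟩ := Finset.prod_dvd_prod_of_subset t (t ∪ s)
    (fun r => a + c • e - algebraMap F A r) Finset.subset_union_left
  obtain ⟨v, hv⟩ := Finset.prod_dvd_prod_of_subset s (t ∪ s)
    (fun r => a + c • e - algebraMap F A r) Finset.subset_union_right
  linear_combination e * hu + (1 - e) * hv + u * hzero + v * hzero'

theorem exists_prod_sub_eq_zero_of_mem_adjoin_idempotents {F A : Type*} [Field F] [CommRing A]
    [Algebra F A] {a : A} (ha : a ∈ Algebra.adjoin F {e : A | IsIdempotentElem e}) :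
    ∃ s : Finset F, ∏ r ∈ s, (a - algebraMap F A r) = 0 := by
  have hidem (e : A) (he : e ∈ Submonoid.closure {e : A | IsIdempotentElem e}) :
      IsIdempotentElem e := by
    induction he using Submonoid.closure_induction with
    | mem x hx => exact hx
    | one => exact IsIdempotentElem.one
    | mul x y _ _ hx hy => exact hx.mul hy
  rw [← Subalgebra.mem_toSubmodule, Algebra.adjoin_eq_span] at ha
  have key (c : F) (b : A) (hb : ∃ s : Finset F, ∏ r ∈ s, (b - algebraMap F A r) = 0) :
      ∃ s : Finset F, ∏ r ∈ s, (b + c • a - algebraMap F A r) = 0 := by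
    induction ha using Submodule.span_induction generalizing c b with
    | mem e he => exact (hidem e he).exists_prod_add_smul_sub_eq_zero c hb
    | zero => simpa using hb
    | add x y _ _ hx hy =>
      rw [smul_add, ← add_assoc]
      exact hy c _ (hx c b hb)
    | smul d x _ hx =>
      rw [smul_smul]
      exact hx (c * d) b hb
  simpa using key 1 0 ⟨{0}, by simp⟩

open Polynomial in
theorem minpoly_map_dvd_of_aeval_one_tmul_eq_zero {K L M : Type*} [Field K] [Field L] [Field M]
    [Algebra K L] [Algebra K M] {x : L} (hx : IsIntegral K x) {f : M[X]}
    (hf : aeval (1 ⊗ₜ[K] x : M ⊗[K] L) f = 0) :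
    (minpoly K x).map (algebraMap K M) ∣ f := by
  set p := (minpoly K x).map (algebraMap K M) with hp
  have hmonic : p.Monic := (minpoly.monic hx).map _
  have hpow : aeval (1 ⊗ₜ[K] x : M ⊗[K] L) p = 0 := by
    have : (1 ⊗ₜ[K] x : M ⊗[K] L) = Algebra.TensorProduct.includeRight x := rfl
    rw [hp, aeval_map_algebraMap, this, aeval_algHom_apply, minpoly.aeval, map_zero]
  rw [← modByMonic_eq_zero_iff_dvd hmonic]
  have hr : aeval (1 ⊗ₜ[K] x : M ⊗[K] L) (f %ₘ p) = 0 := by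
    rw [aeval_modByMonic_eq_self_of_root hpow, hf]
  have hli : LinearIndependent M
      fun i : Fin (minpoly K x).natDegree => (1 ⊗ₜ[K] (x ^ (i : ℕ)) : M ⊗[K] L) := by
    have h := linearIndependent_pow (K := K) x
    let b := Module.Basis.extend h.linearIndepOn_id
    have hmem (i : Fin (minpoly K x).natDegree) := Module.Basis.subset_extend h.linearIndepOn_id
      (Set.mem_range_self (f := fun i : Fin (minpoly K x).natDegree => x ^ (i : ℕ)) i)
    have hb := (b.baseChange M).linearIndependent.comp (fun i => ⟨_, hmem i⟩)
      fun i j hij => h.injective (congrArg Subtype.val hij)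
    convert hb using 2 with i
    simp [b, Module.Basis.extend_apply_self]
  have hdeg : (f %ₘ p).degree < (minpoly K x).natDegree := by
    refine (degree_modByMonic_lt f hmonic).trans_le ?_
    rw [hp, degree_map]
    exact degree_le_natDegree
  rw [Fintype.linearIndependent_iff] at hli
  have hcoeff := hli (fun i => (f %ₘ p).coeff i) <| by
    rw [aeval_def, eval₂_eq_sum, ← sum_fin _ (by simp) hdeg] at hr
    simpa [Algebra.smul_def, Algebra.TensorProduct.tmul_pow] using hr
  ext n
  rw [coeff_zero]
  by_cases hn : n < (minpoly K x).natDegree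
  · exact hcoeff ⟨n, hn⟩
  · exact coeff_eq_zero_of_degree_lt (hdeg.trans_le (by exact_mod_cast not_lt.mp hn))

theorem separable_iff_generated_by_idempotents
    (K L M : Type*) [Field K] [Field L] [Field M]
    [Algebra K L] [Algebra K M]
    [IsAlgClosed M] [Algebra.IsAlgebraic K L] :
    Algebra.IsSeparable K L ↔
      Algebra.adjoin M {e : M ⊗[K] L | IsIdempotentElem e} = ⊤ := by
  classical
  constructor
  · intro hsep
    have hone (x : L) : (1 ⊗ₜ[K] x : M ⊗[K] L) ∈
        Algebra.adjoin M {e : M ⊗[K] L | IsIdempotentElem e} := by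
      set p := (minpoly K x).map (algebraMap K M) with hp
      have hps : p.Separable := Polynomial.Separable.map (Algebra.IsSeparable.isSeparable K x)
      have hpm : p.Monic :=
        (minpoly.monic (Algebra.IsIntegral.isIntegral (R := K) x)).map _
      have hnodal : Lagrange.nodal p.roots.toFinset id = p := by
        rw [Lagrange.nodal_eq, Finset.prod, Multiset.toFinset_val,
          (Polynomial.nodup_roots hps).dedup]
        exact ((IsAlgClosed.splits p).eq_prod_roots_of_monic hpm).symm
      refine mem_adjoin_idempotents_of_aeval_nodal_eq_zero (s := p.roots.toFinset) ?_
      have : (1 ⊗ₜ[K] x : M ⊗[K] L) = Algebra.TensorProduct.includeRight x := rfl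
      rw [hnodal, hp, Polynomial.aeval_map_algebraMap, this, Polynomial.aeval_algHom_apply,
        minpoly.aeval, map_zero]
    rw [eq_top_iff]
    rintro y -
    induction y using TensorProduct.induction_on with
    | zero => exact zero_mem _
    | add y z hy hz => exact add_mem hy hz
    | tmul m x =>
      have : (m ⊗ₜ[K] x : M ⊗[K] L) = m • (1 ⊗ₜ[K] x) := by simp [TensorProduct.smul_tmul']
      rw [this]
      exact Subalgebra.smul_mem _ (hone x) m
  · intro h
    refine ⟨fun x => ?_⟩
    obtain ⟨s, hs⟩ := exists_prod_sub_eq_zero_of_mem_adjoin_idempotents (F := M)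
      (a := (1 ⊗ₜ[K] x : M ⊗[K] L)) (h ▸ Algebra.mem_top)
    have hdvd := minpoly_map_dvd_of_aeval_one_tmul_eq_zero (M := M)
      (Algebra.IsIntegral.isIntegral (R := K) x)
      (f := ∏ r ∈ s, (Polynomial.X - Polynomial.C r)) (by simpa [map_prod] using hs)
    have hsep : (∏ r ∈ s, (Polynomial.X - Polynomial.C (id r : M))).Separable :=
      Polynomial.separable_prod_X_sub_C_iff'.mpr fun _ _ _ _ h => h
    exact (Polynomial.separable_map (algebraMap K M)).mp (hsep.of_dvd hdvd)
end
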